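/- Let A, B, C, D, E, F, G, H be eight distinct points of ℙ²(ℂ) on an irreducible conic. Let 𝒬 be a quartic through all eight points, let 𝒞₁, 𝒞₂, 𝒞₃ be three distinct conics through A, B, C, D, and let 𝒟₁, 𝒟₂, 𝒟₃ be three distinct conics through E, F, G, H. For each of the six pairs (𝒞₁,𝒟₁), (𝒞₂,𝒟₂), (𝒞₃,𝒟₃), (𝒞₃,𝒟₂), (𝒞₁,𝒟₃), (𝒞₂,𝒟₁) assume the quartics 𝒬 and 𝒞ᵢ·𝒟ⱼ have no common nonconstant factor and meet in exactly sixteen distinct points (the eight given points plus eight residual points), and let 𝒳₁, 𝒳₂, 𝒳₃, 𝒴₁, 𝒴₂, 𝒴₃ be mystic conics of these six pairs in order, i.e. conics through the corresponding eight residual points. Assume that for each i = 1, 2, 3 the conics 𝒳ᵢ and 𝒴ᵢ have defining polynomials with no common nonconstant factor and meet in exactly four distinct points, and that the resulting twelve points are distinct. Then these twelve intersection points of 𝒳₁ ∩ 𝒴₁, 𝒳₂ ∩ 𝒴₂ and 𝒳₃ ∩ 𝒴₃ lie on a common conic, i.e. some nonzero homogeneous polynomial of degree 2 vanishes at all twelve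 points. -/

import Mathlib

open MvPolynomial

noncomputable section

/-- Polynomials in three variables over `ℂ`. -/
abbrev Poly3 : Type := MvPolynomial (Fin 3) ℂ

/-- The complex projective plane `ℙ²(ℂ)`, the projectivization of `ℂ³`. -/
abbrev ProjPlane : Type := Projectivization ℂ (Fin 3 → ℂ)

/-- A (homogeneous) polynomial vanishes at a projective point if it vanishes at its
canonical nonzero representative vector (for homogeneous polynomials this is equivalent
to vanishing at any nonzero representative vector). -/
def VanishesAt (F : Poly3) (p : ProjPlane) : Prop :=
  MvPolynomial.eval p.rep F = 0

/-- The set of points of `ℙ²(ℂ)` at which `F` vanishes. -/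
def zeroSet (F : Poly3) : Set ProjPlane := {p | VanishesAt F p}

/-- Two defining polynomials give the same curve iff they are proportional by a
nonzero scalar. -/
def ProportionalTo (F G : Poly3) : Prop := ∃ c : ℂ, c ≠ 0 ∧ G = c • F

/-- A set of points is collinear if some nonzero homogeneous polynomial of degree 1
vanishes at all of them. -/
def Collin (s : Set ProjPlane) : Prop :=
  ∃ L : Poly3, L ≠ 0 ∧ L.IsHomogeneous 1 ∧ ∀ p ∈ s, VanishesAt L p

/-- No three distinct points of `s` are collinear. -/
def NoThreeCollinear (s : Set ProjPlane) : Prop :=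
  ∀ p q r, p ∈ s → q ∈ s → r ∈ s → p ≠ q → p ≠ r → q ≠ r → ¬ Collin {p, q, r}

/-- `L` is a (the) line through the points `p` and `q`. -/
def IsLineThrough (L : Poly3) (p q : ProjPlane) : Prop :=
  L ≠ 0 ∧ L.IsHomogeneous 1 ∧ VanishesAt L p ∧ VanishesAt L q

/-- `L` is the generalized Pascal line of the cubics `D₁` and `D₂` with respect to six
points `A, …, F`: the cubics have no common nonconstant factor, their common zero set
consists of exactly nine distinct points (the six given ones plus three further points),
and `L` is the line through the three further intersection points. -/
def IsGenPascalLine (A B C D E F : ProjPlane) (D₁ D₂ L : Poly3) : Prop :=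
  IsRelPrime D₁ D₂ ∧ L ≠ 0 ∧ L.IsHomogeneous 1 ∧
    ∃ P Q R : ProjPlane,
      ([A, B, C, D, E, F, P, Q, R] : List ProjPlane).Pairwise (· ≠ ·) ∧
      zeroSet D₁ ∩ zeroSet D₂ = {A, B, C, D, E, F, P, Q, R} ∧
      VanishesAt L P ∧ VanishesAt L Q ∧ VanishesAt L R

theorem eval_smul_of_isHomogeneous {σ : Type*} {F : MvPolynomial σ ℂ} {n : ℕ}
    (hF : F.IsHomogeneous n) (c : ℂ) (x : σ → ℂ) :
    eval (c • x) F = c ^ n * eval x F := by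
  rw [eval_eq, eval_eq, Finset.mul_sum]
  refine Finset.sum_congr rfl fun d hd => ?_
  have hdeg : ∑ i ∈ d.support, d i = n := hF.degree_eq_sum_deg_support hd ▸ rfl
  simp only [Pi.smul_apply, smul_eq_mul, mul_pow, Finset.prod_mul_distrib,
    Finset.prod_pow_eq_pow_sum, hdeg]
  ring

theorem homogeneousComponent_mul_of_isHomogeneous_left {σ : Type*} {F G : MvPolynomial σ ℂ}
    {m : ℕ} (hF : F.IsHomogeneous m) (n : ℕ) :
    homogeneousComponent (m + n) (F * G) = F * homogeneousComponent n G := by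
  conv_lhs => rw [← sum_homogeneousComponent G, Finset.mul_sum, map_sum]
  have h : ∀ i, homogeneousComponent (m + n) (F * homogeneousComponent i G) =
      if n = i then F * homogeneousComponent i G else 0 := fun i => by
    rw [homogeneousComponent_of_mem (hF.mul (homogeneousComponent_isHomogeneous i G))]
    simp only [Nat.add_left_cancel_iff]
  rw [Finset.sum_congr rfl fun i _ => h i, Finset.sum_ite_eq]
  split_ifs with hn
  · rfl
  · rw [homogeneousComponent_eq_zero _ _ (by simpa using hn), mul_zero]

theorem exists_isHomogeneous_mul_eq {F M : Poly3} {m n : ℕ} (hF : F.IsHomogeneous m)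
    (hM : M.IsHomogeneous (m + n)) (h : F ∣ M) : ∃ N : Poly3, N.IsHomogeneous n ∧ M = F * N := by
  obtain ⟨G, rfl⟩ := h
  refine ⟨homogeneousComponent n G, homogeneousComponent_isHomogeneous n G, ?_⟩
  rw [← homogeneousComponent_mul_of_isHomogeneous_left hF, homogeneousComponent_eq_self hM]

theorem isHomogeneous_one_of_constantCoeff_eq_zero {σ : Type*} {F : MvPolynomial σ ℂ}
    (hF : F.totalDegree = 1) (h0 : constantCoeff F = 0) : F.IsHomogeneous 1 := by
  have h := sum_homogeneousComponent F
  rw [hF, Finset.sum_range_succ, Finset.sum_range_one, homogeneousComponent_zero,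
    ← constantCoeff_eq, h0, C_0, zero_add] at h
  exact h ▸ homogeneousComponent_isHomogeneous 1 F

theorem exists_linear_factors {X : Poly3} (hX0 : X ≠ 0) (hX : X.IsHomogeneous 2)
    (hirr : ¬ Irreducible X) :
    ∃ L M : Poly3, L.IsHomogeneous 1 ∧ M.IsHomogeneous 1 ∧ X = L * M := by
  have hdeg := hX.totalDegree hX0
  have hnu : ¬ IsUnit X := fun h => by
    have := (isUnit_iff_totalDegree_of_isReduced.mp h).2
    omega
  have hpos : ∀ F : Poly3, F ≠ 0 → ¬ IsUnit F → F.totalDegree ≠ 0 := fun F hF0 hF h => hF <| by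
    rw [totalDegree_eq_zero_iff_eq_C] at h
    rw [h] at hF0 ⊢
    exact (IsUnit.mk0 _ fun h => hF0 (by rw [h, C_0])).map C
  rw [irreducible_iff] at hirr
  push Not at hirr
  obtain ⟨f, g, rfl, hf, hg⟩ := hirr hnu
  have hf0 := left_ne_zero_of_mul hX0
  have hg0 := right_ne_zero_of_mul hX0
  rw [totalDegree_mul_of_isDomain hf0 hg0] at hdeg
  have hf1 := hpos f hf0 hf
  have hg1 := hpos g hg0 hg
  have hcc : constantCoeff (f * g) = 0 := by
    rw [constantCoeff_eq]
    exact hX.coeff_eq_zero (by simp)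
  rw [map_mul, mul_eq_zero] at hcc
  rcases hcc with h | h
  · have hfh := isHomogeneous_one_of_constantCoeff_eq_zero (by omega) h
    obtain ⟨M, hM, h⟩ := exists_isHomogeneous_mul_eq (n := 1) hfh hX (dvd_mul_right f g)
    exact ⟨f, M, hfh, hM, h⟩
  · have hgh := isHomogeneous_one_of_constantCoeff_eq_zero (by omega) h
    obtain ⟨M, hM, h⟩ := exists_isHomogeneous_mul_eq (n := 1) hgh hX (dvd_mul_left g f)
    exact ⟨g, M, hgh, hM, h⟩

/-- A binary form of degree `m` with more than `m` zeros on the projective line vanishes. -/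
theorem eval_binary_eq_zero {G : MvPolynomial (Fin 2) ℂ} {m : ℕ} (hG : G.IsHomogeneous m)
    {ι : Type*} [Fintype ι] (hcard : m < Fintype.card ι) (w : ι → Fin 2 → ℂ)
    (hw0 : ∀ i, w i ≠ 0) (hw : ∀ i j, i ≠ j → w i 0 * w j 1 ≠ w i 1 * w j 0)
    (hGw : ∀ i, eval (w i) G = 0) (v : Fin 2 → ℂ) (hv : v ≠ 0) : eval v G = 0 := by
  classical
  have key : ∀ u : Fin 2 → ℂ, u ≠ 0 → ∀ c : ℂ, c ≠ u 1 / u 0 → u 1 - u 0 * c ≠ 0 := by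
    intro u hu c hc h
    by_cases h0 : u 0 = 0
    · refine hu (funext fun i => ?_)
      fin_cases i
      · exact h0
      · simpa [h0] using h
    · exact hc (by field_simp; linear_combination -h)
  obtain ⟨c, hc⟩ := Infinite.exists_notMem_finset
    (insert (v 1 / v 0) (Finset.univ.image fun i => w i 1 / w i 0))
  simp only [Finset.mem_insert, Finset.mem_image, Finset.mem_univ, true_and, not_or,
    not_exists] at hc
  let f : Fin 2 → Polynomial ℂ := ![Polynomial.X, Polynomial.C c * Polynomial.X + 1]
  have hfdeg : ∀ i, (f i).natDegree ≤ 1 := by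
    intro i
    fin_cases i
    · simp [f]
    · simp only [f, Fin.mk_one, Matrix.cons_val_one, Matrix.cons_val_fin_one]
      compute_degree
  have hp : ∀ u : Fin 2 → ℂ, u 1 - u 0 * c ≠ 0 →
      eval u G = (u 1 - u 0 * c) ^ m * (aeval f G).eval (u 0 / (u 1 - u 0 * c)) := by
    intro u hu
    have h1 : ∀ (P : MvPolynomial (Fin 2) ℂ) (τ : ℂ),
        (aeval f P).eval τ = eval (fun i => (f i).eval τ) P := fun P τ => by
      induction P using MvPolynomial.induction_on <;> simp_all
    rw [h1, ← eval_smul_of_isHomogeneous hG]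
    congr 2
    funext i
    fin_cases i
    · simp [f]; field_simp
    · simp [f]; field_simp; ring
  have hroot : ∀ i, (aeval f G).eval (w i 0 / (w i 1 - w i 0 * c)) = 0 := fun i => by
    have hne := key (w i) (hw0 i) c fun h => hc.2 i h.symm
    have := hp (w i) hne
    rw [hGw i] at this
    exact (mul_eq_zero.mp this.symm).resolve_left (pow_ne_zero _ hne)
  have hzero : aeval f G = 0 := by
    refine Polynomial.eq_zero_of_natDegree_lt_card_of_eval_eq_zero _ (fun i j hij => ?_) hroot ?_
    · by_contra hne
      refine hw i j hne ?_
      have hi := key (w i) (hw0 i) c fun h => hc.2 i h.symm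
      have hj := key (w j) (hw0 j) c fun h => hc.2 j h.symm
      rw [div_eq_div_iff hi hj] at hij
      linear_combination hij
    · exact (MvPolynomial.aeval_natDegree_le G hG.totalDegree_le f hfdeg).trans_lt (by simpa)
  rw [hp v (key v hv c hc.1), hzero]
  simp

theorem dvd_of_forall_eval_eq_zero {Z F : Poly3} (hZ : Irreducible Z)
    (h : ∀ x, eval x Z = 0 → eval x F = 0) : Z ∣ F := by
  have hprime : (Ideal.span {Z}).IsPrime :=
    (Ideal.span_singleton_prime hZ.ne_zero).mpr hZ.prime
  rw [← Ideal.mem_span_singleton, ← hprime.radical,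
    ← vanishingIdeal_zeroLocus_eq_radical (K := ℂ), mem_vanishingIdeal_iff]
  intro x hx
  rw [zeroLocus_span] at hx
  have haeval : ∀ P : Poly3, aeval x P = eval x P := fun P => by
    rw [← coe_aeval_eq_eval, RingHom.coe_coe]
  rw [haeval]
  exact h x (haeval Z ▸ hx Z rfl)

/-- Bézout's bound for a plane curve with a rational parametrization of degree `d`: a form of
degree `n` with more than `d * n` zeros on the curve is divisible by its equation. -/
theorem dvd_of_parametrization {Z F : Poly3} {d n : ℕ} (hZ : Irreducible Z)
    (φ : Fin 3 → MvPolynomial (Fin 2) ℂ) (hφ : ∀ i, (φ i).IsHomogeneous d)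
    (hsurj : ∀ x, x ≠ 0 → eval x Z = 0 →
      ∃ w, w ≠ 0 ∧ ∃ c : ℂ, c ≠ 0 ∧ (fun i => eval w (φ i)) = c • x)
    (hF : F.IsHomogeneous n) (hn : n ≠ 0) (S : Finset ProjPlane) (hS : d * n < S.card)
    (hSZ : ∀ p ∈ S, VanishesAt Z p) (hSF : ∀ p ∈ S, VanishesAt F p) : Z ∣ F := by
  have hpt : ∀ p : S, ∃ w, w ≠ 0 ∧ ∃ c : ℂ, c ≠ 0 ∧
      (fun i => eval w (φ i)) = c • (p : ProjPlane).rep :=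
    fun p => hsurj _ (Projectivization.rep_nonzero _) (hSZ p p.2)
  choose w hw0 c hc hwc using hpt
  have heval : ∀ (P : Poly3) (u : Fin 2 → ℂ),
      eval u (aeval φ P) = eval (fun i => eval u (φ i)) P := fun P u => by
    induction P using MvPolynomial.induction_on <;> simp_all
  have hvan := eval_binary_eq_zero (G := aeval φ F) (m := d * n) (hF.aeval φ hφ)
    (by simpa using hS) w hw0 (fun p q hpq hdet => ?_) fun p => ?_
  · refine dvd_of_forall_eval_eq_zero hZ fun x hx => ?_
    by_cases hx0 : x = 0
    · have := eval_smul_of_isHomogeneous hF 0 x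
      rwa [zero_pow hn, zero_mul, zero_smul, ← hx0] at this
    · obtain ⟨u, hu, a, ha, hua⟩ := hsurj x hx0 hx
      have := hvan u hu
      rw [heval, hua, eval_smul_of_isHomogeneous hF] at this
      exact (mul_eq_zero.mp this).resolve_left (pow_ne_zero _ ha)
  · have hprop : ∃ k : ℂ, w p = k • w q := by
      by_cases h0 : w q 0 = 0
      · have h1 : w q 1 ≠ 0 := fun h1 => hw0 q (by ext i; fin_cases i <;> assumption)
        refine ⟨w p 1 / w q 1, ?_⟩
        ext i
        fin_cases i
        · simp only [Fin.zero_eta, Pi.smul_apply, smul_eq_mul, h0, mul_zero]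
          simpa [h0, h1] using hdet
        · simp [h1]
      · refine ⟨w p 0 / w q 0, ?_⟩
        ext i
        fin_cases i
        · simp [h0]
        · simp only [Fin.mk_one, Pi.smul_apply, smul_eq_mul]
          field_simp
          linear_combination -hdet
    obtain ⟨k, hk⟩ := hprop
    have h1 : c p • (p : ProjPlane).rep = (k ^ d * c q) • (q : ProjPlane).rep := by
      rw [mul_smul, ← hwc p, ← hwc q, hk]
      funext i
      exact eval_smul_of_isHomogeneous (hφ i) k (w q)
    apply hpq
    apply Subtype.ext
    rw [← (p : ProjPlane).mk_rep, ← (q : ProjPlane).mk_rep, Projectivization.mk_eq_mk_iff']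
    exact ⟨(c p)⁻¹ * (k ^ d * c q), by rw [mul_smul, ← h1, inv_smul_smul₀ (hc p)]⟩
  · rw [heval, hwc, eval_smul_of_isHomogeneous hF, show eval _ F = 0 from hSF p p.2, mul_zero]

/-- The linear form with coefficient vector `l`. -/
def linForm (l : Fin 3 → ℂ) : Poly3 := ∑ i, C (l i) * X i

theorem eval_linForm (l x : Fin 3 → ℂ) : eval x (linForm l) = l ⬝ᵥ x := by
  simp [linForm, dotProduct]

theorem isHomogeneous_linForm (l : Fin 3 → ℂ) : (linForm l).IsHomogeneous 1 :=
  IsHomogeneous.sum _ _ _ fun i _ => isHomogeneous_C_mul_X (l i) i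

theorem linForm_ne_zero {l : Fin 3 → ℂ} (hl : l ≠ 0) : linForm l ≠ 0 := fun h => hl <| by
  ext i
  simpa [h] using (eval_linForm l (Pi.single i 1)).symm

theorem exists_eq_linForm {L : Poly3} (hL : L.IsHomogeneous 1) : ∃ l, L = linForm l := by
  rw [← mem_homogeneousSubmodule, homogeneousSubmodule_one_eq_span_X,
    Submodule.mem_span_range_iff_exists_fun] at hL
  obtain ⟨l, rfl⟩ := hL
  exact ⟨l, Finset.sum_congr rfl fun i _ => smul_eq_C_mul _ _⟩

theorem exists_spanning_pair {l : Fin 3 → ℂ} (hl : l ≠ 0) :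
    ∃ u v : Fin 3 → ℂ, ∀ x, l ⬝ᵥ x = 0 → ∃ s t : ℂ, x = s • u + t • v := by
  have h : l 0 ≠ 0 ∨ l 1 ≠ 0 ∨ l 2 ≠ 0 := by
    by_contra! h
    exact hl (by ext i; fin_cases i <;> simp [h])
  simp only [dotProduct, Fin.sum_univ_three]
  rcases h with h | h | h
  · refine ⟨![-l 1 / l 0, 1, 0], ![-l 2 / l 0, 0, 1], fun x hx => ⟨x 1, x 2, ?_⟩⟩
    ext i; fin_cases i <;> simp
    field_simp; linear_combination hx
  · refine ⟨![1, -l 0 / l 1, 0], ![0, -l 2 / l 1, 1], fun x hx => ⟨x 0, x 2, ?_⟩⟩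
    ext i; fin_cases i <;> simp
    field_simp; linear_combination hx
  · refine ⟨![1, 0, -l 0 / l 2], ![0, 1, -l 1 / l 2], fun x hx => ⟨x 0, x 1, ?_⟩⟩
    ext i; fin_cases i <;> simp
    field_simp; linear_combination hx

theorem irreducible_of_isHomogeneous_one {L : Poly3} (hL : L.IsHomogeneous 1) (hL0 : L ≠ 0) :
    Irreducible L := by
  refine irreducible_of_totalDegree_eq_one (hL.totalDegree hL0) fun x hx => ?_
  obtain ⟨d, hd⟩ := ne_zero_iff.mp hL0
  exact isUnit_of_dvd_unit (hx d) (IsUnit.mk0 _ hd)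

/-- A form of degree `n` with more than `n` zeros on a line is divisible by its equation. -/
theorem line_dvd {L F : Poly3} {n : ℕ} (hL : L.IsHomogeneous 1) (hL0 : L ≠ 0)
    (hF : F.IsHomogeneous n) (hn : n ≠ 0) (S : Finset ProjPlane) (hS : n < S.card)
    (hSL : ∀ p ∈ S, VanishesAt L p) (hSF : ∀ p ∈ S, VanishesAt F p) : L ∣ F := by
  obtain ⟨l, rfl⟩ := exists_eq_linForm hL
  have hl : l ≠ 0 := by rintro rfl; exact hL0 (by simp [linForm])
  obtain ⟨u, v, huv⟩ := exists_spanning_pair hl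
  refine dvd_of_parametrization (d := 1) (irreducible_of_isHomogeneous_one hL hL0)
    (fun i => C (u i) * X 0 + C (v i) * X 1)
    (fun i => (isHomogeneous_C_mul_X _ _).add (isHomogeneous_C_mul_X _ _))
    (fun x hx0 hx => ?_) hF hn S (by simpa using hS) hSL hSF
  rw [eval_linForm] at hx
  obtain ⟨s, t, rfl⟩ := huv x hx
  refine ⟨![s, t], fun h => hx0 ?_, 1, one_ne_zero, ?_⟩
  · have h0 : s = 0 := congrFun h 0
    have h1 : t = 0 := congrFun h 1
    simp [h0, h1]
  · ext i
    simp [mul_comm]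

theorem exists_bilinear {K : Poly3} (hK : K.IsHomogeneous 2) :
    ∃ b : (Fin 3 → ℂ) →ₗ[ℂ] (Fin 3 → ℂ) →ₗ[ℂ] ℂ, ∀ x, eval x K = b x x := by
  rw [← mem_homogeneousSubmodule, ← homogeneousSubmodule_one_pow, pow_two] at hK
  induction hK using Submodule.mul_induction_on' with
  | mem_mul_mem L hL M hM =>
    obtain ⟨l, rfl⟩ := exists_eq_linForm hL
    obtain ⟨m, rfl⟩ := exists_eq_linForm hM
    refine ⟨LinearMap.mk₂ ℂ (fun x y => (l ⬝ᵥ x) * (m ⬝ᵥ y)) ?_ ?_ ?_ ?_, fun x => ?_⟩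
    · intros; simp [dotProduct_add]; ring
    · intros; simp; ring
    · intros; simp [dotProduct_add]; ring
    · intros; simp; ring
    · simp [eval_linForm]
  | add x _ y _ hx hy =>
    obtain ⟨b, hb⟩ := hx
    obtain ⟨b', hb'⟩ := hy
    exact ⟨b + b', fun x => by simp [hb, hb']⟩

theorem vanishesAt_mk {F : Poly3} {n : ℕ} (hF : F.IsHomogeneous n) {v : Fin 3 → ℂ}
    (hv : v ≠ 0) (h : eval v F = 0) : VanishesAt F (Projectivization.mk ℂ v hv) := by
  obtain ⟨a, ha⟩ := Projectivization.exists_smul_eq_mk_rep ℂ v hv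
  rw [VanishesAt, ← ha, Units.smul_def, eval_smul_of_isHomogeneous hF, h, mul_zero]

theorem not_dvd_conic {K L : Poly3} (hK : K.IsHomogeneous 2) (hKirr : Irreducible K)
    (hL : L.IsHomogeneous 1) (hL0 : L ≠ 0) : ¬ L ∣ K := by
  intro h
  obtain ⟨N, hN, rfl⟩ := exists_isHomogeneous_mul_eq (n := 1) hL hK h
  have hN0 := right_ne_zero_of_mul hKirr.ne_zero
  exact (hKirr.isUnit_or_isUnit rfl).elim (irreducible_of_isHomogeneous_one hL hL0).not_isUnit
    (irreducible_of_isHomogeneous_one hN hN0).not_isUnit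

theorem polar_ne_zero {K : Poly3} (hK : K.IsHomogeneous 2) (hKirr : Irreducible K)
    {b : (Fin 3 → ℂ) →ₗ[ℂ] (Fin 3 → ℂ) →ₗ[ℂ] ℂ} (hb : ∀ x, eval x K = b x x)
    {x y : Fin 3 → ℂ} (hxy : LinearIndependent ℂ ![x, y]) (hx : b x x = 0) (hy : b y y = 0) :
    b x y + b y x ≠ 0 := by
  classical
  intro h
  have hind := LinearIndependent.pair_iff.mp hxy
  have hx0 : x ≠ 0 := fun h => by simpa [h] using hind 1 0
  have hy0 : y ≠ 0 := fun h => by simpa [h] using hind 0 1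
  have hxy0 : x + y ≠ 0 := fun h => by simpa [h] using hind 1 1
  have hl := crossProduct_ne_zero_iff_linearIndependent.mpr hxy
  have hL := isHomogeneous_linForm (crossProduct x y)
  refine not_dvd_conic hK hKirr hL (linForm_ne_zero hl) ?_
  refine line_dvd hL (linForm_ne_zero hl) hK two_ne_zero {Projectivization.mk ℂ x hx0,
    Projectivization.mk ℂ y hy0, Projectivization.mk ℂ (x + y) hxy0} ?_ ?_ ?_
  · rw [Finset.card_eq_three.mpr ⟨_, _, _, ?_, ?_, ?_, rfl⟩]
    · simp
    all_goals
      rw [Ne, Projectivization.mk_eq_mk_iff']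
      rintro ⟨a, ha⟩
    · simpa using hind (-1) a (by rw [ha]; simp)
    · have := hind (a - 1) a (by rw [← sub_eq_zero.mpr ha]; module)
      simp_all
    · have := hind a (a - 1) (by rw [← sub_eq_zero.mpr ha]; module)
      simp_all
  · have hx' : crossProduct x y ⬝ᵥ x = 0 := by rw [dotProduct_comm, dot_self_cross]
    have hy' : crossProduct x y ⬝ᵥ y = 0 := by rw [dotProduct_comm, dot_cross_self]
    simp only [Finset.mem_insert, Finset.mem_singleton]
    rintro p (rfl | rfl | rfl) <;> apply vanishesAt_mk hL <;>
      simp [eval_linForm, dotProduct_add, hx', hy']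
  · simp only [Finset.mem_insert, Finset.mem_singleton]
    rintro p (rfl | rfl | rfl) <;> apply vanishesAt_mk hK
    · rw [hb, hx]
    · rw [hb, hy]
    · rw [hb]
      simp only [map_add, LinearMap.add_apply]
      linear_combination h + hx + hy

theorem exists_complement {a : Fin 3 → ℂ} (ha : a ≠ 0) :
    ∃ u v : Fin 3 → ℂ, (∀ x, ∃ α s t : ℂ, x = α • a + (s • u + t • v)) ∧
      ∀ α s t : ℂ, s • u + t • v = α • a → s = 0 ∧ t = 0 := by
  have h : a 0 ≠ 0 ∨ a 1 ≠ 0 ∨ a 2 ≠ 0 := by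
    by_contra! h
    exact ha (by ext i; fin_cases i <;> simp [h])
  rcases h with h | h | h
  · refine ⟨![0, 1, 0], ![0, 0, 1], fun x => ⟨x 0 / a 0, x 1 - x 0 / a 0 * a 1,
      x 2 - x 0 / a 0 * a 2, ?_⟩, fun α s t hst => ?_⟩
    · ext i; fin_cases i <;> simp [h]
    · have h0 := congrFun hst 0
      have h1 := congrFun hst 1
      have h2 := congrFun hst 2
      simp_all
  · refine ⟨![1, 0, 0], ![0, 0, 1], fun x => ⟨x 1 / a 1, x 0 - x 1 / a 1 * a 0,
      x 2 - x 1 / a 1 * a 2, ?_⟩, fun α s t hst => ?_⟩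
    · ext i; fin_cases i <;> simp [h]
    · have h0 := congrFun hst 0
      have h1 := congrFun hst 1
      have h2 := congrFun hst 2
      simp_all
  · refine ⟨![1, 0, 0], ![0, 1, 0], fun x => ⟨x 2 / a 2, x 0 - x 2 / a 2 * a 0,
      x 1 - x 2 / a 2 * a 1, ?_⟩, fun α s t hst => ?_⟩
    · ext i; fin_cases i <;> simp [h]
    · have h0 := congrFun hst 0
      have h1 := congrFun hst 1
      have h2 := congrFun hst 2
      simp_all

/-- A form of degree `n` with more than `2 * n` zeros on an irreducible conic is divisible by
its equation. -/
theorem conic_dvd {K F : Poly3} {n : ℕ} (hK : K.IsHomogeneous 2) (hKirr : Irreducible K)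
    (hF : F.IsHomogeneous n) (hn : n ≠ 0) (S : Finset ProjPlane) (hS : 2 * n < S.card)
    (hSK : ∀ p ∈ S, VanishesAt K p) (hSF : ∀ p ∈ S, VanishesAt F p) : K ∣ F := by
  obtain ⟨b, hb⟩ := exists_bilinear hK
  obtain ⟨p, hp⟩ : S.Nonempty := Finset.card_pos.mp (by omega)
  obtain ⟨a, ha0, ha⟩ : ∃ a : Fin 3 → ℂ, a ≠ 0 ∧ b a a = 0 :=
    ⟨p.rep, p.rep_nonzero, hb p.rep ▸ hSK p hp⟩
  obtain ⟨u, v, hspan, hind⟩ := exists_complement ha0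
  -- The second intersection with the conic of the line joining `a` to `s • u + t • v`.
  let φ : Fin 3 → MvPolynomial (Fin 2) ℂ := fun i =>
    (C (b a u + b u a) * X 0 + C (b a v + b v a) * X 1) * (C (u i) * X 0 + C (v i) * X 1) -
      (C (a i * b u u) * X 0 ^ 2 + C (a i * (b u v + b v u)) * (X 0 * X 1) +
        C (a i * b v v) * X 1 ^ 2)
  have hφ : ∀ i, (φ i).IsHomogeneous 2 := fun i =>
    (((isHomogeneous_C_mul_X _ _).add (isHomogeneous_C_mul_X _ _)).mul
      ((isHomogeneous_C_mul_X _ _).add (isHomogeneous_C_mul_X _ _))).sub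
      (((isHomogeneous_C_mul_X_pow _ _ _).add
        (((isHomogeneous_X ℂ _).mul (isHomogeneous_X ℂ _)).C_mul _)).add
        (isHomogeneous_C_mul_X_pow _ _ _))
  have hφ_eval : ∀ s t : ℂ, (fun i => eval ![s, t] (φ i)) =
      (b a (s • u + t • v) + b (s • u + t • v) a) • (s • u + t • v) -
        b (s • u + t • v) (s • u + t • v) • a := fun s t => by
    funext i
    simp [φ]
    ring
  have hw0 : ∀ s t : ℂ, s • u + t • v ≠ 0 → ![s, t] ≠ 0 := fun s t h h' => h <| by
    have h0 : s = 0 := congrFun h' 0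
    have h1 : t = 0 := congrFun h' 1
    simp [h0, h1]
  refine dvd_of_parametrization hKirr φ hφ (fun x hx0 hx => ?_) hF hn S hS hSK hSF
  obtain ⟨α, s, t, rfl⟩ := hspan x
  by_cases hst : s • u + t • v = 0
  · rw [hst, add_zero] at hx0 ⊢
    have hα : α ≠ 0 := fun h => hx0 (by rw [h, zero_smul])
    obtain ⟨σ, τ, hne, hzero⟩ : ∃ σ τ : ℂ, (σ ≠ 0 ∨ τ ≠ 0) ∧
        σ * (b a u + b u a) + τ * (b a v + b v a) = 0 := by
      by_cases hβ : b a u + b u a = 0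
      · exact ⟨1, 0, by simp, by simp [hβ]⟩
      · exact ⟨-(b a v + b v a), b a u + b u a, Or.inr hβ, by ring⟩
    have hnot : ∀ c : ℂ, σ • u + τ • v ≠ c • a := fun c h => by
      have := hind c σ τ h
      tauto
    have hpolar : b a (σ • u + τ • v) + b (σ • u + τ • v) a = 0 := by
      simp only [map_add, map_smul, LinearMap.add_apply, LinearMap.smul_apply, smul_eq_mul]
      linear_combination hzero
    have hK0 : b (σ • u + τ • v) (σ • u + τ • v) ≠ 0 := fun h => by
      refine polar_ne_zero hK hKirr hb ?_ ha h hpolar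
      exact (LinearIndependent.pair_iff' ha0).mpr fun c hc => hnot c hc.symm
    refine ⟨![σ, τ], hw0 σ τ (by simpa using hnot 0), -(b (σ • u + τ • v) (σ • u + τ • v)) / α,
      div_ne_zero (neg_ne_zero.mpr hK0) hα, ?_⟩
    rw [hφ_eval, hpolar, smul_smul, div_mul_cancel₀ _ hα, zero_smul, zero_sub, neg_smul]
  · have hnot : ∀ c : ℂ, c • a ≠ s • u + t • v := fun c h => by
      obtain ⟨rfl, rfl⟩ := hind c s t h.symm
      simp at hst
    refine ⟨![s, t], hw0 s t hst, b a (s • u + t • v) + b (s • u + t • v) a, ?_, ?_⟩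
    all_goals
      rw [hb] at hx
      try rw [hφ_eval]
      generalize s • u + t • v = y at *
      have hrel : α * (b a y + b y a) + b y y = 0 := by
        simp only [map_add, map_smul, LinearMap.add_apply, LinearMap.smul_apply,
          smul_eq_mul] at hx
        linear_combination hx - α ^ 2 * ha
    · intro h
      rw [h, mul_zero, zero_add] at hrel
      exact polar_ne_zero hK hKirr hb ((LinearIndependent.pair_iff' ha0).mpr hnot) ha hrel h
    · rw [eq_neg_of_add_eq_zero_right hrel]
      module

theorem eq_C_mul_of_dvd {X N : Poly3} (hX : X.IsHomogeneous 2) (hN : N.IsHomogeneous 2)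
    (hN0 : N ≠ 0) (h : X ∣ N) : ∃ c : ℂ, c ≠ 0 ∧ N = C c * X := by
  obtain ⟨P, hP, rfl⟩ := exists_isHomogeneous_mul_eq (n := 0) hX hN h
  obtain ⟨c, rfl⟩ : ∃ c, P = C c :=
    ⟨_, totalDegree_eq_zero_iff_eq_C.mp (Nat.le_zero.mp hP.totalDegree_le)⟩
  exact ⟨c, by rintro rfl; simp at hN0, mul_comm _ _⟩

theorem vanishesAt_mul {F G : Poly3} {p : ProjPlane} :
    VanishesAt (F * G) p ↔ VanishesAt F p ∨ VanishesAt G p := by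
  simp [VanishesAt]

/-- If two coprime quartics pass through eight points, these points lie on at most one conic. -/
theorem conic_through_eight_unique {Q G X N : Poly3} (hQ : Q.IsHomogeneous 4)
    (hG : G.IsHomogeneous 4) (hrel : IsRelPrime Q G) (R : Finset ProjPlane) (hR : 8 ≤ R.card)
    (hRQ : ∀ p ∈ R, VanishesAt Q p) (hRG : ∀ p ∈ R, VanishesAt G p)
    (hX : X.IsHomogeneous 2) (hX0 : X ≠ 0) (hRX : ∀ p ∈ R, VanishesAt X p)
    (hN : N.IsHomogeneous 2) (hN0 : N ≠ 0) (hRN : ∀ p ∈ R, VanishesAt N p) :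
    ∃ c : ℂ, c ≠ 0 ∧ N = C c * X := by
  classical
  refine eq_C_mul_of_dvd hX hN hN0 ?_
  by_cases hirr : Irreducible X
  · exact conic_dvd hX hirr hN two_ne_zero R (by omega) hRX hRN
  obtain ⟨L, M, hL, hM, rfl⟩ := exists_linear_factors hX0 hX hirr
  have hL0 := left_ne_zero_of_mul hX0
  have hM0 := right_ne_zero_of_mul hX0
  have hline : ∀ P : Poly3, P.IsHomogeneous 1 → P ≠ 0 →
      (R.filter (VanishesAt P)).card ≤ 4 := by
    intro P hP hP0
    by_contra! hcard
    refine (irreducible_of_isHomogeneous_one hP hP0).not_isUnit (hrel ?_ ?_)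
    · exact line_dvd hP hP0 hQ four_ne_zero _ hcard (by simp) (by simp +contextual [hRQ])
    · exact line_dvd hP hP0 hG four_ne_zero _ hcard (by simp) (by simp +contextual [hRG])
  have hcompl : ∀ P : Poly3, P.IsHomogeneous 1 → P ≠ 0 →
      4 ≤ (R.filter fun p => ¬ VanishesAt P p).card := by
    intro P hP hP0
    have := R.card_filter_add_card_filter_not (VanishesAt P)
    have := hline P hP hP0
    omega
  have hLN : L ∣ N := by
    refine line_dvd hL hL0 hN two_ne_zero (R.filter fun p => ¬ VanishesAt M p)
      (by have := hcompl M hM hM0; omega)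
      (fun p hp => ?_) (fun p hp => hRN p (Finset.mem_filter.mp hp).1)
    rw [Finset.mem_filter] at hp
    exact (vanishesAt_mul.mp (hRX p hp.1)).resolve_right hp.2
  obtain ⟨M', hM', rfl⟩ := exists_isHomogeneous_mul_eq (n := 1) hL hN hLN
  refine mul_dvd_mul_left L ?_
  refine line_dvd hM hM0 hM' one_ne_zero (R.filter fun p => ¬ VanishesAt L p)
    (by have := hcompl L hL hL0; omega)
    (fun p hp => ?_) (fun p hp => ?_)
  all_goals rw [Finset.mem_filter] at hp
  · exact (vanishesAt_mul.mp (hRX p hp.1)).resolve_left hp.2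
  · exact (vanishesAt_mul.mp (hRN p hp.1)).resolve_left hp.2

/-- A conic cut out residually on the irreducible conic `K` by a member of the pencil of two
quartics is the mystic conic. -/
theorem mystic_conic_unique {K Q G X N : Poly3} (hK : K.IsHomogeneous 2)
    (hKirr : Irreducible K) (hQ : Q.IsHomogeneous 4) (hG : G.IsHomogeneous 4)
    (hrel : IsRelPrime Q G) (T R : Finset ProjPlane) (hT : T.card = 8) (hR : R.card = 8)
    (hTR : Disjoint R T)
    (hTK : ∀ p ∈ T, VanishesAt K p) (hTQ : ∀ p ∈ T, VanishesAt Q p)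
    (hTG : ∀ p ∈ T, VanishesAt G p) (hRQ : ∀ p ∈ R, VanishesAt Q p)
    (hRG : ∀ p ∈ R, VanishesAt G p)
    (hX : X.IsHomogeneous 2) (hX0 : X ≠ 0) (hRX : ∀ p ∈ R, VanishesAt X p)
    (hN : N.IsHomogeneous 2) (hN0 : N ≠ 0) {a b : ℂ} (hKN : K * N = C a * G - C b * Q) :
    ∃ c : ℂ, c ≠ 0 ∧ N = C c * X := by
  classical
  refine conic_through_eight_unique hQ hG hrel R hR.ge hRQ hRG hX hX0 hRX hN hN0 fun p hp => ?_
  have hpK : ¬ VanishesAt K p := by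
    intro hpK
    have hpT : p ∉ T := Finset.disjoint_left.mp hTR hp
    have hcard : 2 * 4 < (insert p T).card := by rw [Finset.card_insert_of_notMem hpT, hT]; simp
    refine hKirr.not_isUnit (hrel ?_ ?_)
    · refine conic_dvd hK hKirr hQ four_ne_zero (insert p T) hcard ?_ ?_ <;>
        simp_all
    · refine conic_dvd hK hKirr hG four_ne_zero (insert p T) hcard ?_ ?_ <;>
        simp_all
  refine (vanishesAt_mul.mp (?_ : VanishesAt (K * N) p)).resolve_left hpK
  have h1 : eval p.rep Q = 0 := hRQ p hp
  have h2 : eval p.rep G = 0 := hRG p hp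
  simp [hKN, VanishesAt, h1, h2]

theorem exists_linForm_vanishing (p : ProjPlane) :
    ∃ L : Poly3, L.IsHomogeneous 1 ∧ L ≠ 0 ∧ VanishesAt L p := by
  obtain ⟨l, hl, h⟩ : ∃ l : Fin 3 → ℂ, l ≠ 0 ∧ l ⬝ᵥ p.rep = 0 := by
    by_cases h : p.rep 0 = 0
    · exact ⟨![1, 0, 0], fun h => one_ne_zero (congrFun h 0), by
        simpa [dotProduct, Fin.sum_univ_three] using h⟩
    · exact ⟨![-p.rep 1, p.rep 0, 0], fun h' => h (congrFun h' 1), by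
        simp [dotProduct, Fin.sum_univ_three]; ring⟩
  exact ⟨linForm l, isHomogeneous_linForm l, linForm_ne_zero hl, by
    rw [VanishesAt, eval_linForm, h]⟩

theorem exists_notMem_of_conic {K : Poly3} (hK : K.IsHomogeneous 2) (hKirr : Irreducible K)
    (T : Finset ProjPlane) (hT : T.Nonempty) : ∃ p ∉ T, VanishesAt K p := by
  by_contra! hcon
  choose L hL hL0 hLp using exists_linForm_vanishing
  have hdvd : K ∣ ∏ p ∈ T, L p := by
    refine dvd_of_forall_eval_eq_zero hKirr fun x hx => ?_
    by_cases hx0 : x = 0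
    · obtain ⟨p, hp⟩ := hT
      rw [map_prod]
      refine Finset.prod_eq_zero hp ?_
      have := eval_smul_of_isHomogeneous (hL p) 0 x
      rwa [zero_smul, pow_one, zero_mul, ← hx0] at this
    · have hmem : Projectivization.mk ℂ x hx0 ∈ T := by
        by_contra hmem
        exact hcon _ hmem (vanishesAt_mk hK hx0 hx)
      rw [map_prod]
      refine Finset.prod_eq_zero hmem ?_
      obtain ⟨a, ha⟩ := Projectivization.exists_smul_eq_mk_rep ℂ x hx0
      have := hLp (Projectivization.mk ℂ x hx0)
      rw [VanishesAt, ← ha, Units.smul_def, eval_smul_of_isHomogeneous (hL _)] at this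
      exact (mul_eq_zero.mp this).resolve_left (pow_ne_zero _ a.ne_zero)
  obtain ⟨p, -, hp⟩ := hKirr.prime.exists_mem_finset_dvd hdvd
  obtain ⟨P, hP⟩ := hp
  have hP0 : K * P ≠ 0 := hP ▸ hL0 p
  have h1 := (hL p).totalDegree (hL0 p)
  rw [hP, totalDegree_mul_of_isDomain hKirr.ne_zero (right_ne_zero_of_mul hP0),
    hK.totalDegree hKirr.ne_zero] at h1
  omega

/-- Three pairwise non-proportional vectors in a space separated by two functionals satisfy a
linear relation with nonzero coefficients. -/
theorem exists_relation {E : Type*} [AddCommGroup E] [Module ℂ E] (V : Submodule ℂ E)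
    (f g : E →ₗ[ℂ] ℂ) (hfg : ∀ x ∈ V, f x = 0 → g x = 0 → x = 0) {c : Fin 3 → E}
    (hc : ∀ i, c i ∈ V) (hc0 : ∀ i, c i ≠ 0)
    (hne : ∀ i j, i < j → ∀ t : ℂ, t ≠ 0 → c j ≠ t • c i) :
    ∃ α : Fin 3 → ℂ, (∀ i, α i ≠ 0) ∧ α 0 • c 0 + α 1 • c 1 + α 2 • c 2 = 0 := by
  have hdet : ∀ i j, i < j → f (c i) * g (c j) - f (c j) * g (c i) ≠ 0 := by
    intro i j hij h
    have hf : f (c j) • c i = f (c i) • c j := sub_eq_zero.mp <|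
      hfg _ (V.sub_mem (V.smul_mem _ (hc i)) (V.smul_mem _ (hc j)))
        (by simp; ring) (by simp; linear_combination -h)
    have hg : g (c j) • c i = g (c i) • c j := sub_eq_zero.mp <|
      hfg _ (V.sub_mem (V.smul_mem _ (hc i)) (V.smul_mem _ (hc j)))
        (by simp; linear_combination h) (by simp; ring)
    have key : ∀ s t : ℂ, s • c i = t • c j → s = 0 ∧ t = 0 := by
      intro s t hst
      have ht : t = 0 := by
        by_contra ht
        refine hne i j hij (t⁻¹ * s) (mul_ne_zero (inv_ne_zero ht) ?_) ?_
        · rintro rfl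
          rw [zero_smul] at hst
          exact (smul_ne_zero ht (hc0 j)) hst.symm
        · rw [mul_smul, hst, inv_smul_smul₀ ht]
      refine ⟨?_, ht⟩
      rw [ht, zero_smul] at hst
      exact (smul_eq_zero.mp hst).resolve_right (hc0 i)
    exact hc0 i (hfg _ (hc i) (key _ _ hf).2 (key _ _ hg).2)
  refine ⟨![f (c 1) * g (c 2) - f (c 2) * g (c 1), -(f (c 0) * g (c 2) - f (c 2) * g (c 0)),
    f (c 0) * g (c 1) - f (c 1) * g (c 0)], fun i => ?_, hfg _ ?_ ?_ ?_⟩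
  · fin_cases i
    · exact hdet 1 2 (by simp)
    · exact neg_ne_zero.mpr (hdet 0 2 (by simp))
    · exact hdet 0 1 (by simp)
  · exact V.add_mem (V.add_mem (V.smul_mem _ (hc 0)) (V.smul_mem _ (hc 1))) (V.smul_mem _ (hc 2))
  · simp; ring
  · simp; ring

theorem vanishesAt_combination {F G : Poly3} {p : ProjPlane} {a b : ℂ} (hF : VanishesAt F p)
    (hG : VanishesAt G p) : VanishesAt (C a * F - C b * G) p := by
  rw [VanishesAt] at *
  simp [hF, hG]

theorem not_isRelPrime_of_proportional {X Y : Poly3} (hX : X.IsHomogeneous 2) (hX0 : X ≠ 0)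
    {a b : ℂ} (hb : b ≠ 0) (h : C a * X = C b * Y) : ¬ IsRelPrime X Y := by
  intro hrel
  have hY : Y = C (b⁻¹ * a) * X := by
    rw [C_mul, mul_assoc, h, ← mul_assoc, ← C_mul, inv_mul_cancel₀ hb, C_1, one_mul]
  have := isUnit_iff_totalDegree_of_isReduced.mp (hrel dvd_rfl (hY ▸ dvd_mul_left X _))
  rw [hX.totalDegree hX0] at this
  omega

/-- Three pairwise distinct conics through four points of an irreducible conic are linearly
dependent, with nonzero coefficients. -/
theorem exists_pencil_relation {K : Poly3} (hK : K.IsHomogeneous 2) (hKirr : Irreducible K)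
    (T : Finset ProjPlane) (hT : T.card = 4) (hTK : ∀ p ∈ T, VanishesAt K p)
    {p : ProjPlane} (hp : p ∉ T) (hpK : VanishesAt K p) {c : Fin 3 → Poly3}
    (hc : ∀ i, c i ≠ 0 ∧ (c i).IsHomogeneous 2 ∧ ∀ q ∈ T, VanishesAt (c i) q)
    (hne : ∀ i j, i < j → ¬ ProportionalTo (c i) (c j)) :
    ∃ α : Fin 3 → ℂ, (∀ i, α i ≠ 0) ∧ C (α 0) * c 0 + C (α 1) * c 1 + C (α 2) * c 2 = 0 := by
  classical
  obtain ⟨q, hq⟩ : ∃ q, eval q K ≠ 0 := by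
    by_contra! h
    exact hKirr.ne_zero (funext fun q => by rw [h q, map_zero])
  let V : Submodule ℂ Poly3 :=
    homogeneousSubmodule (Fin 3) ℂ 2 ⊓ ⨅ t ∈ T, LinearMap.ker (aeval t.rep).toLinearMap
  have hV : ∀ F, F ∈ V ↔ F.IsHomogeneous 2 ∧ ∀ t ∈ T, VanishesAt F t := fun F => by
    simp [V, VanishesAt, aeval_eq_eval]
  have hsep : ∀ F ∈ V, (aeval p.rep).toLinearMap F = 0 → (aeval q).toLinearMap F = 0 →
      F = 0 := by
    intro F hF hFp hFq
    obtain ⟨hF, hFT⟩ := (hV F).mp hF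
    have hFp' : VanishesAt F p := by simpa [VanishesAt, aeval_eq_eval] using hFp
    by_contra hF0
    have hdvd : K ∣ F := conic_dvd hK hKirr hF two_ne_zero (insert p T)
      (by rw [Finset.card_insert_of_notMem hp, hT]; simp)
      (by simp_all) (by simp_all)
    obtain ⟨a, ha, rfl⟩ := eq_C_mul_of_dvd hK hF hF0 hdvd
    simp [aeval_eq_eval, ha, hq] at hFq
  obtain ⟨α, hα, h⟩ := exists_relation V _ _ hsep (c := c)
    (fun i => (hV _).mpr (hc i).2) (fun i => (hc i).1)
    fun i j hij t ht h => hne i j hij ⟨t, ht, h⟩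
  exact ⟨α, hα, by simpa only [smul_eq_C_mul] using h⟩

/-- A scalar multiple of the mystic conic is the residual of `K` in the member of the pencil
spanned by the two quartics that passes through a further point `p` of `K`. -/
theorem exists_mystic_scalar {K Q G X : Poly3} (hK : K.IsHomogeneous 2)
    (hKirr : Irreducible K) (hQ : Q.IsHomogeneous 4) (hG : G.IsHomogeneous 4)
    (hrel : IsRelPrime Q G) (T R : Finset ProjPlane) (hT : T.card = 8) (hR : R.card = 8)
    (hTR : Disjoint R T)
    (hTK : ∀ p ∈ T, VanishesAt K p) (hTQ : ∀ p ∈ T, VanishesAt Q p)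
    (hTG : ∀ p ∈ T, VanishesAt G p) (hRQ : ∀ p ∈ R, VanishesAt Q p)
    (hRG : ∀ p ∈ R, VanishesAt G p)
    (hX : X.IsHomogeneous 2) (hX0 : X ≠ 0) (hRX : ∀ p ∈ R, VanishesAt X p)
    {p : ProjPlane} (hpT : p ∉ T) (hpK : VanishesAt K p) (hpQ : ¬ VanishesAt Q p) :
    ∃ e : ℂ, e ≠ 0 ∧ K * (C e * X) = C (eval p.rep Q) * G - C (eval p.rep G) * Q := by
  classical
  have hM : (C (eval p.rep Q) * G - C (eval p.rep G) * Q).IsHomogeneous 4 :=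
    (hG.C_mul _).sub (hQ.C_mul _)
  have hdvd : K ∣ C (eval p.rep Q) * G - C (eval p.rep G) * Q := by
    refine conic_dvd hK hKirr hM four_ne_zero (insert p T)
      (by rw [Finset.card_insert_of_notMem hpT, hT]; simp) (by simp_all) fun t ht => ?_
    rcases Finset.mem_insert.mp ht with rfl | ht
    · simp [VanishesAt, mul_comm]
    · have h1 : eval t.rep Q = 0 := hTQ t ht
      have h2 : eval t.rep G = 0 := hTG t ht
      simp [VanishesAt, h1, h2]
  obtain ⟨N, hN, hKN⟩ := exists_isHomogeneous_mul_eq (n := 2) hK hM hdvd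
  have hN0 : N ≠ 0 := by
    rintro rfl
    rw [mul_zero, sub_eq_zero] at hKN
    have hunit : IsUnit (C (eval p.rep Q) : Poly3) := (IsUnit.mk0 _ hpQ).map C
    have hQG : Q ∣ G := (hunit.dvd_mul_left).mp (hKN ▸ dvd_mul_left Q _)
    have hQ0 : Q ≠ 0 := by rintro rfl; exact hpQ (map_zero _)
    have := isUnit_iff_totalDegree_of_isReduced.mp (hrel dvd_rfl hQG)
    rw [hQ.totalDegree hQ0] at this
    omega
  obtain ⟨e, he, rfl⟩ := mystic_conic_unique hK hKirr hQ hG hrel T R hT hR hTR hTK hTQ hTG hRQ hRG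
    hX hX0 hRX hN hN0 hKN.symm
  exact ⟨e, he, hKN.symm⟩

/-- Let `𝒬` be a quartic through eight distinct points of an irreducible conic,
`𝒞₁, 𝒞₂, 𝒞₃` three distinct conics through `A,B,C,D` and `𝒟₁, 𝒟₂, 𝒟₃` three distinct
conics through `E,F,G,H`. Let `𝒳₁, 𝒳₂, 𝒳₃, 𝒴₁, 𝒴₂, 𝒴₃` be the mystic conics of the
six pairs `(𝒞₁,𝒟₁), (𝒞₂,𝒟₂), (𝒞₃,𝒟₃), (𝒞₃,𝒟₂), (𝒞₁,𝒟₃), (𝒞₂,𝒟₁)` (for the pair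
indexed by `k : Fin 6`, `r k : Fin 8 → ProjPlane` enumerates the residual intersection
points of `𝒬` with the corresponding reducible quartic). Then the twelve intersection
points of `𝒳₁ ∩ 𝒴₁`, `𝒳₂ ∩ 𝒴₂`, `𝒳₃ ∩ 𝒴₃` (enumerated by `s : Fin 3 → Fin 4 → _`,
all distinct) lie on a common conic. -/
theorem octagon_steiner_conic (A B C D E F G H : ProjPlane)
    (hdist : ([A, B, C, D, E, F, G, H] : List ProjPlane).Pairwise (· ≠ ·))
    (K : Poly3) (hKh : K.IsHomogeneous 2) (hKirr : Irreducible K)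
    (honK : ∀ p ∈ [A, B, C, D, E, F, G, H], VanishesAt K p)
    (𝒬 : Poly3) (h𝒬0 : 𝒬 ≠ 0) (h𝒬h : 𝒬.IsHomogeneous 4)
    (hon𝒬 : ∀ p ∈ [A, B, C, D, E, F, G, H], VanishesAt 𝒬 p)
    (C₁ C₂ C₃ : Poly3)
    (hC : ∀ Ci ∈ [C₁, C₂, C₃], Ci ≠ 0 ∧ Ci.IsHomogeneous 2 ∧
      ∀ p ∈ [A, B, C, D], VanishesAt Ci p)
    (hCne : ¬ ProportionalTo C₁ C₂ ∧ ¬ ProportionalTo C₁ C₃ ∧ ¬ ProportionalTo C₂ C₃)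
    (D₁ D₂ D₃ : Poly3)
    (hD : ∀ Di ∈ [D₁, D₂, D₃], Di ≠ 0 ∧ Di.IsHomogeneous 2 ∧
      ∀ p ∈ [E, F, G, H], VanishesAt Di p)
    (hDne : ¬ ProportionalTo D₁ D₂ ∧ ¬ ProportionalTo D₁ D₃ ∧ ¬ ProportionalTo D₂ D₃)
    (r : Fin 6 → Fin 8 → ProjPlane)
    (hrinj : ∀ k, Function.Injective (r k))
    (hrdisj : ∀ k i, r k i ∉ ({A, B, C, D, E, F, G, H} : Set ProjPlane))
    (hrel : ∀ k, IsRelPrime 𝒬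
      (![C₁ * D₁, C₂ * D₂, C₃ * D₃, C₃ * D₂, C₁ * D₃, C₂ * D₁] k))
    (hzero : ∀ k, zeroSet 𝒬 ∩
      zeroSet (![C₁ * D₁, C₂ * D₂, C₃ * D₃, C₃ * D₂, C₁ * D₃, C₂ * D₁] k) =
      {A, B, C, D, E, F, G, H} ∪ Set.range (r k))
    (X₁ X₂ X₃ Y₁ Y₂ Y₃ : Poly3)
    (hXY : ∀ k : Fin 6, ![X₁, X₂, X₃, Y₁, Y₂, Y₃] k ≠ 0 ∧
      (![X₁, X₂, X₃, Y₁, Y₂, Y₃] k).IsHomogeneous 2 ∧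
      ∀ i, VanishesAt (![X₁, X₂, X₃, Y₁, Y₂, Y₃] k) (r k i))
    (hXYrel : ∀ i : Fin 3, IsRelPrime (![X₁, X₂, X₃] i) (![Y₁, Y₂, Y₃] i))
    (s : Fin 3 → Fin 4 → ProjPlane)
    (hs : ∀ i : Fin 3, zeroSet (![X₁, X₂, X₃] i) ∩ zeroSet (![Y₁, Y₂, Y₃] i) =
      Set.range (s i))
    (hsdist : ∀ i j i' j', s i j = s i' j' → i = i' ∧ j = j') :
    ∃ W : Poly3, W ≠ 0 ∧ W.IsHomogeneous 2 ∧ ∀ i j, VanishesAt W (s i j) := by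
  classical
  let T : Finset ProjPlane := [A, B, C, D, E, F, G, H].toFinset
  have hTcard : T.card = 8 := List.toFinset_card_of_nodup hdist
  have hTK : ∀ p ∈ T, VanishesAt K p := fun p hp => honK p (List.mem_toFinset.mp hp)
  have hTQ : ∀ p ∈ T, VanishesAt 𝒬 p := fun p hp => hon𝒬 p (List.mem_toFinset.mp hp)
  obtain ⟨p, hpT, hpK⟩ := exists_notMem_of_conic hKh hKirr T
    (Finset.card_pos.mp (by rw [hTcard]; simp))
  have hRcard : ∀ k, (Finset.univ.image (r k)).card = 8 := fun k => by
    rw [Finset.card_image_of_injective _ (hrinj k)]; simp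
  have hRT : ∀ k, Disjoint (Finset.univ.image (r k)) T := fun k => by
    rw [Finset.disjoint_left]
    intro q hq
    obtain ⟨i, -, rfl⟩ := Finset.mem_image.mp hq
    simpa [T] using hrdisj k i
  have hRzero : ∀ k, ∀ q ∈ Finset.univ.image (r k), VanishesAt 𝒬 q ∧ VanishesAt
      (![C₁ * D₁, C₂ * D₂, C₃ * D₃, C₃ * D₂, C₁ * D₃, C₂ * D₁] k) q := fun k q hq => by
    obtain ⟨i, -, rfl⟩ := Finset.mem_image.mp hq
    exact (hzero k).symm.subset (Or.inr ⟨i, rfl⟩)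
  have hTzero : ∀ k, ∀ q ∈ T, VanishesAt
      (![C₁ * D₁, C₂ * D₂, C₃ * D₃, C₃ * D₂, C₁ * D₃, C₂ * D₁] k) q := fun k q hq =>
    ((hzero k).symm.subset (Or.inl (by simpa [T] using hq))).2
  have hRX : ∀ k, ∀ q ∈ Finset.univ.image (r k),
      VanishesAt (![X₁, X₂, X₃, Y₁, Y₂, Y₃] k) q := fun k q hq => by
    obtain ⟨i, -, rfl⟩ := Finset.mem_image.mp hq
    exact (hXY k).2.2 i
  have hGh : ∀ k, (![C₁ * D₁, C₂ * D₂, C₃ * D₃, C₃ * D₂, C₁ * D₃, C₂ * D₁] k).IsHomogeneous 4 := by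
    have hCh : ∀ P ∈ [C₁, C₂, C₃], P.IsHomogeneous 2 := fun P hP => (hC P hP).2.1
    have hDh : ∀ P ∈ [D₁, D₂, D₃], P.IsHomogeneous 2 := fun P hP => (hD P hP).2.1
    intro k
    fin_cases k <;> exact (hCh _ (by simp)).mul (hDh _ (by simp))
  have hX₁ : X₁ ≠ 0 ∧ X₁.IsHomogeneous 2 := ⟨(hXY 0).1, (hXY 0).2.1⟩
  have hpQ : ¬ VanishesAt 𝒬 p := by
    intro hpQ
    have hdvd : K ∣ 𝒬 := conic_dvd hKh hKirr h𝒬h four_ne_zero (insert p T)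
      (by rw [Finset.card_insert_of_notMem hpT, hTcard]; simp) (by simp_all) (by simp_all)
    obtain ⟨S, hS, hKS⟩ := exists_isHomogeneous_mul_eq (n := 2) hKh h𝒬h hdvd
    have hS0 : S ≠ 0 := by rintro rfl; exact h𝒬0 (by rw [hKS, mul_zero])
    have hprop : ∀ k, ∃ c : ℂ, c ≠ 0 ∧
        S = MvPolynomial.C c * ![X₁, X₂, X₃, Y₁, Y₂, Y₃] k := fun k =>
      mystic_conic_unique hKh hKirr h𝒬h (hGh k) (hrel k) T _ hTcard (hRcard k) (hRT k) hTK hTQ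
        (hTzero k) (fun q hq => (hRzero k q hq).1) (fun q hq => (hRzero k q hq).2)
        (hXY k).2.1 (hXY k).1 (hRX k) hS hS0 (a := 0) (b := -1) (by simp [hKS])
    obtain ⟨a, -, ha⟩ := hprop 0
    obtain ⟨b, hb, hb'⟩ := hprop 3
    exact not_isRelPrime_of_proportional hX₁.2 hX₁.1 hb (ha.symm.trans hb') (hXYrel 0)
  have hscalar : ∀ k, ∃ e : ℂ, e ≠ 0 ∧
      K * (MvPolynomial.C e * ![X₁, X₂, X₃, Y₁, Y₂, Y₃] k) = _ := fun k =>
    exists_mystic_scalar hKh hKirr h𝒬h (hGh k) (hrel k) T _ hTcard (hRcard k) (hRT k) hTK hTQ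
      (hTzero k) (fun q hq => (hRzero k q hq).1) (fun q hq => (hRzero k q hq).2)
      (hXY k).2.1 (hXY k).1 (hRX k) hpT hpK hpQ
  choose e he hKe using hscalar
  have hsubC : ∀ q ∈ [A, B, C, D], q ∈ [A, B, C, D, E, F, G, H] := by simp +contextual
  have hsubD : ∀ q ∈ [E, F, G, H], q ∈ [A, B, C, D, E, F, G, H] := by simp +contextual
  have hndC : [A, B, C, D].Nodup := (List.sublist_append_left _ [E, F, G, H]).nodup hdist
  have hndD : [E, F, G, H].Nodup := (List.sublist_append_right [A, B, C, D] _).nodup hdist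
  obtain ⟨α, hα, hαC⟩ := exists_pencil_relation hKh hKirr [A, B, C, D].toFinset
    (List.toFinset_card_of_nodup hndC)
    (fun q hq => honK q (hsubC q (List.mem_toFinset.mp hq)))
    (fun hp => hpT (List.mem_toFinset.mpr (hsubC p (List.mem_toFinset.mp hp)))) hpK
    (c := ![C₁, C₂, C₃])
    (fun i => by
      have := hC (![C₁, C₂, C₃] i) (by fin_cases i <;> simp)
      simpa only [List.mem_toFinset] using this)
    (by simpa [Fin.forall_fin_succ, and_assoc] using hCne)
  obtain ⟨δ, hδ, hδD⟩ := exists_pencil_relation hKh hKirr [E, F, G, H].toFinset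
    (List.toFinset_card_of_nodup hndD)
    (fun q hq => honK q (hsubD q (List.mem_toFinset.mp hq)))
    (fun hp => hpT (List.mem_toFinset.mpr (hsubD p (List.mem_toFinset.mp hp)))) hpK
    (c := ![D₁, D₂, D₃])
    (fun i => by
      have := hD (![D₁, D₂, D₃] i) (by fin_cases i <;> simp)
      simpa only [List.mem_toFinset] using this)
    (by simpa [Fin.forall_fin_succ, and_assoc] using hDne)
  have hαp := congrArg (fun P => MvPolynomial.C (σ := Fin 3) (eval p.rep P)) hαC
  have hδp := congrArg (fun P => MvPolynomial.C (σ := Fin 3) (eval p.rep P)) hδD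
  have h0 := hKe 0
  have h1 := hKe 1
  have h2 := hKe 2
  have h3 := hKe 3
  have h4 := hKe 4
  have h5 := hKe 5
  simp only [Matrix.cons_val, map_add, map_mul, eval_C, map_zero] at hαC hδD hαp hδp h0 h1 h2 h3 h4 h5
  have hK0 := hKirr.ne_zero
  let S : Fin 3 → Poly3 := ![
    MvPolynomial.C (α 0 * δ 0 * e 0) * X₁ - MvPolynomial.C (α 2 * δ 1 * e 3) * Y₁,
    MvPolynomial.C (α 1 * δ 1 * e 1) * X₂ - MvPolynomial.C (α 0 * δ 2 * e 4) * Y₂,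
    MvPolynomial.C (α 2 * δ 2 * e 2) * X₃ - MvPolynomial.C (α 1 * δ 0 * e 5) * Y₃]
  have h01 : S 0 = S 1 := by
    apply mul_left_cancel₀ hK0
    simp only [S, Matrix.cons_val, C_mul]
    linear_combination
      MvPolynomial.C (α 0) * MvPolynomial.C (δ 0) * h0
      - MvPolynomial.C (α 2) * MvPolynomial.C (δ 1) * h3
      - MvPolynomial.C (α 1) * MvPolynomial.C (δ 1) * h1
      + MvPolynomial.C (α 0) * MvPolynomial.C (δ 2) * h4
      + MvPolynomial.C (eval p.rep 𝒬) *
        (MvPolynomial.C (α 0) * C₁ * hδD - MvPolynomial.C (δ 1) * D₂ * hαC)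
      - 𝒬 * (MvPolynomial.C (α 0) * MvPolynomial.C (eval p.rep C₁) * hδp
        - MvPolynomial.C (δ 1) * MvPolynomial.C (eval p.rep D₂) * hαp)
  have h02 : S 0 = S 2 := by
    apply mul_left_cancel₀ hK0
    simp only [S, Matrix.cons_val, C_mul]
    linear_combination
      MvPolynomial.C (α 0) * MvPolynomial.C (δ 0) * h0
      - MvPolynomial.C (α 2) * MvPolynomial.C (δ 1) * h3
      - MvPolynomial.C (α 2) * MvPolynomial.C (δ 2) * h2
      + MvPolynomial.C (α 1) * MvPolynomial.C (δ 0) * h5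
      - MvPolynomial.C (eval p.rep 𝒬) *
        (MvPolynomial.C (α 2) * C₃ * hδD - MvPolynomial.C (δ 0) * D₁ * hαC)
      + 𝒬 * (MvPolynomial.C (α 2) * MvPolynomial.C (eval p.rep C₃) * hδp
        - MvPolynomial.C (δ 0) * MvPolynomial.C (eval p.rep D₁) * hαp)
  have hS : ∀ i, S 0 = S i := by
    intro i
    fin_cases i
    exacts [rfl, h01, h02]
  refine ⟨S 0, fun h => ?_, ((hXY 0).2.1.C_mul _).sub ((hXY 3).2.1.C_mul _), fun i j => ?_⟩
  · exact not_isRelPrime_of_proportional hX₁.2 hX₁.1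
      (mul_ne_zero (mul_ne_zero (hα 2) (hδ 1)) (he 3)) (sub_eq_zero.mp h) (hXYrel 0)
  · rw [hS i]
    obtain ⟨hx, hy⟩ := (hs i).symm.subset ⟨j, rfl⟩
    fin_cases i <;> exact vanishesAt_combination hx hy
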